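/- Gale characterization of zeta-dimension: for every A ⊆ ℤ⁺, Dim_ζ(A) = inf{ s ∈ [0,∞) : there is an s-gale d that succeeds on every element of A }. -/

import Mathlib

/-- The zeta-dimension of a set of positive integers:
`Dim_ζ(A) = inf { s ∈ [0,∞) : Σ_{n ∈ A} n^{-s} < ∞ }`. -/
noncomputable def zetaDim (A : Set ℕ+) : ℝ :=
  sInf {s : ℝ | 0 ≤ s ∧ (∑' n : A, (((n : ℕ+) : ℕ) : ENNReal) ^ (-s)) < ⊤}

/-- An `s`-gale is `d : {0,1}* → [0,∞)` with `d(w) = 2^{−s}[d(w0) + d(w1)]` for all `w`. -/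
def IsGale (s : ℝ) (d : List Bool → ℝ) : Prop :=
  (∀ w, 0 ≤ d w) ∧
    ∀ w, d w = (2 : ℝ) ^ (-s) * (d (w ++ [false]) + d (w ++ [true]))

/-- An `s`-gale `d` succeeds on `n ∈ ℤ⁺` if `d(w) ≥ 1` where `w` is the standard binary
representation (no leading zeroes, most significant bit first) of `n`. -/
def SucceedsOn (d : List Bool → ℝ) (n : ℕ+) : Prop :=
  1 ≤ d ((Nat.bits (n : ℕ)).reverse)

/-- The `s`-gale that starts with capital `2 ^ (-s * |v|)`, bets everything on the word `v`
until it is reached, and bets evenly afterwards. -/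
noncomputable def wordGale (s : ℝ) (v w : List Bool) : ℝ :=
  if w <+: v then (2 : ℝ) ^ (s * ((w.length : ℝ) - v.length))
  else if v <+: w then (2 : ℝ) ^ ((s - 1) * ((w.length : ℝ) - v.length)) else 0

theorem wordGale_self (s : ℝ) (v : List Bool) : wordGale s v v = 1 := by
  simp [wordGale]

theorem wordGale_of_prefix {s : ℝ} {v w : List Bool} (h : w <+: v) :
    wordGale s v w = (2 : ℝ) ^ (s * ((w.length : ℝ) - v.length)) := by
  simp [wordGale, h]

theorem wordGale_of_extension {s : ℝ} {v w : List Bool} (h : v <+: w) :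
    wordGale s v w = (2 : ℝ) ^ ((s - 1) * ((w.length : ℝ) - v.length)) := by
  by_cases h' : w <+: v
  · have hlen : w.length = v.length := le_antisymm h'.length_le h.length_le
    simp [wordGale_of_prefix h', hlen]
  · simp [wordGale, h, h']

theorem wordGale_of_incomparable {s : ℝ} {v w : List Bool} (h : ¬ w <+: v) (h' : ¬ v <+: w) :
    wordGale s v w = 0 := by
  simp [wordGale, h, h']

theorem isGale_wordGale (s : ℝ) (v : List Bool) : IsGale s (wordGale s v) := by
  refine ⟨fun w => by unfold wordGale; split_ifs <;> positivity, fun w => ?_⟩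
  by_cases h : v <+: w
  · have hb (b : Bool) : wordGale s v (w ++ [b])
        = (2 : ℝ) ^ (s - 1) * wordGale s v w := by
      rw [wordGale_of_extension h, wordGale_of_extension (h.trans (List.prefix_append _ _)),
        ← Real.rpow_add two_pos]
      congr 1
      simp only [List.length_append, List.length_singleton]
      push_cast
      ring
    rw [hb, hb, ← two_mul, ← mul_assoc, ← mul_assoc, Real.rpow_sub_one two_ne_zero,
      Real.rpow_neg two_pos.le]
    field_simp
  by_cases h' : w <+: v
  · obtain ⟨u, rfl⟩ := h'
    cases u with
    | nil => simp at h
    | cons b u =>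
      have h0 : wordGale s (w ++ b :: u) (w ++ [!b]) = 0 := by
        apply wordGale_of_incomparable
        · rw [List.prefix_append_right_inj]; simp
        · rw [List.prefix_append_right_inj]; simp
      have h1 : wordGale s (w ++ b :: u) w
          = (2 : ℝ) ^ (-s) * wordGale s (w ++ b :: u) (w ++ [b]) := by
        rw [wordGale_of_prefix (List.prefix_append _ _),
          wordGale_of_prefix (by rw [List.prefix_append_right_inj]; simp),
          ← Real.rpow_add two_pos]
        congr 1
        simp only [List.length_append, List.length_singleton]
        push_cast
        ring
      cases b <;> simp_all
  · have hb (b : Bool) : wordGale s v (w ++ [b]) = 0 := by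
      apply wordGale_of_incomparable
      · exact fun hp => h' ((List.prefix_append _ _).trans hp)
      · intro hp
        rcases List.prefix_concat_iff.1 hp with rfl | hp
        · exact h' (List.prefix_append _ _)
        · exact h hp
    simp [hb, wordGale_of_incomparable h' h]

namespace IsGale

variable {s : ℝ} {d : List Bool → ℝ}

theorem add_eq (hd : IsGale s d) (w : List Bool) :
    d (w ++ [false]) + d (w ++ [true]) = (2 : ℝ) ^ s * d w := by
  rw [hd.2 w, ← mul_assoc, ← Real.rpow_add two_pos]
  simp

theorem append_le (hd : IsGale s d) (w : List Bool) (b : Bool) :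
    d (w ++ [b]) ≤ (2 : ℝ) ^ s * d w := by
  rw [← hd.add_eq]
  cases b
  · linarith [hd.1 (w ++ [true])]
  · linarith [hd.1 (w ++ [false])]

/-- A family of `s`-gales with summable initial capitals is summable at every word. -/
theorem summable {ι : Type*} {d : ι → List Bool → ℝ} (hd : ∀ i, IsGale s (d i))
    (h : Summable fun i => d i []) (w : List Bool) : Summable fun i => d i w := by
  induction w using List.reverseRecOn with
  | nil => exact h
  | append_singleton w b ih =>
    exact (ih.mul_left _).of_nonneg_of_le (fun i => (hd i).1 _) fun i => (hd i).append_le w b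

/-- A sum of `s`-gales with summable initial capitals is an `s`-gale. -/
theorem tsum {ι : Type*} {d : ι → List Bool → ℝ} (hd : ∀ i, IsGale s (d i))
    (h : Summable fun i => d i []) : IsGale s fun w => ∑' i, d i w := by
  refine ⟨fun w => tsum_nonneg fun i => (hd i).1 w, fun w => ?_⟩
  rw [← (summable hd h _).tsum_add (summable hd h _), ← tsum_mul_left]
  exact tsum_congr fun i => (hd i).2 w

/-- Total capital of a gale on the binary representations of a given length. -/
theorem sum_Ico_bits (hd : IsGale s d) (l : ℕ) :
    ∑ n ∈ Finset.Ico (2 ^ l) (2 ^ (l + 1)), d (Nat.bits n).reverse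
      = ((2 : ℝ) ^ s) ^ l * d [true] := by
  have key (a b : ℕ) (ha : 0 < a) (hab : a ≤ b) :
      ∑ n ∈ Finset.Ico (2 * a) (2 * b), d (Nat.bits n).reverse
        = (2 : ℝ) ^ s * ∑ n ∈ Finset.Ico a b, d (Nat.bits n).reverse := by
    induction b, hab using Nat.le_induction with
    | base => simp
    | succ b hb ih =>
      rw [show 2 * (b + 1) = 2 * b + 1 + 1 by ring, Finset.sum_Ico_succ_top (by omega),
        Finset.sum_Ico_succ_top (by omega), Finset.sum_Ico_succ_top hb, ih, mul_add,
        ← hd.add_eq, Nat.bit0_bits b (by omega), Nat.bit1_bits]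
      simp [add_assoc]
  induction l with
  | zero => simp
  | succ l ih =>
    rw [pow_succ' 2 l, pow_succ' 2 (l + 1), key _ _ (by positivity)
      (Nat.pow_le_pow_right two_pos (Nat.le_succ l)), ih, pow_succ']
    ring

end IsGale

theorem length_bits_rpow_le (s : ℝ) (hs : 0 ≤ s) (n : ℕ+) :
    (2 : ℝ) ^ (-s * ((Nat.bits n).length : ℝ)) ≤ (n : ℝ) ^ (-s) := by
  rw [mul_comm, Real.rpow_mul two_pos.le, Real.rpow_natCast]
  apply Real.rpow_le_rpow_of_nonpos (by exact_mod_cast n.pos) _ (by linarith)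
  rw [Nat.size_eq_bits_len]
  exact_mod_cast (Nat.lt_size_self n).le

theorem ofReal_pnat_rpow (n : ℕ+) (s : ℝ) :
    (((n : ℕ+) : ℕ) : ENNReal) ^ (-s) = ENNReal.ofReal ((n : ℝ) ^ (-s)) := by
  rw [← ENNReal.ofReal_rpow_of_pos (by exact_mod_cast n.pos), ENNReal.ofReal_natCast]

theorem zetaSum_lt_top_iff (A : Set ℕ+) (s : ℝ) :
    (∑' n : A, (((n : ℕ+) : ℕ) : ENNReal) ^ (-s)) < ⊤ ↔
      Summable fun n : A => (((n : ℕ+) : ℕ) : ℝ) ^ (-s) := by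
  simp_rw [ofReal_pnat_rpow]
  constructor
  · intro h
    refine (ENNReal.summable_toReal h.ne).congr fun n => ?_
    exact ENNReal.toReal_ofReal (by positivity)
  · exact fun h => h.tsum_ofReal_lt_top

theorem exists_isGale_of_summable {A : Set ℕ+} {s : ℝ} (hs : 0 ≤ s)
    (h : Summable fun n : A => (((n : ℕ+) : ℕ) : ℝ) ^ (-s)) :
    ∃ d : List Bool → ℝ, IsGale s d ∧ ∀ n ∈ A, SucceedsOn d n := by
  let e : A → List Bool → ℝ := fun n => wordGale s (Nat.bits (n : ℕ+)).reverse
  have he (n : A) : IsGale s (e n) := isGale_wordGale _ _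
  have h0 : Summable fun n => e n [] := by
    refine h.of_nonneg_of_le (fun n => (he n).1 _) fun n => ?_
    refine le_trans (le_of_eq ?_) (length_bits_rpow_le s hs n)
    simp [e, wordGale]
  refine ⟨_, IsGale.tsum he h0, fun n hn => ?_⟩
  have := (IsGale.summable he h0 (Nat.bits n).reverse).le_tsum ⟨n, hn⟩ fun m _ => (he m).1 _
  simpa [e, wordGale_self, SucceedsOn] using this

theorem IsGale.summable_of_succeedsOn {A : Set ℕ+} {s t : ℝ} (hs : 0 ≤ s) (hst : s < t)
    {d : List Bool → ℝ} (hd : IsGale s d) (hA : ∀ n ∈ A, SucceedsOn d n) :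
    Summable fun n : A => (((n : ℕ+) : ℕ) : ℝ) ^ (-t) := by
  let B : Set ℕ := (fun n : ℕ+ => (n : ℕ)) '' A
  let f : ℕ → ℝ := B.indicator fun n => (n : ℝ) ^ (-t)
  have hf0 (n : ℕ) : 0 ≤ f n := Set.indicator_nonneg (fun n _ => by positivity) n
  set r : ℝ := (2 : ℝ) ^ (s - t) with hr
  have hr0 : 0 ≤ r := by positivity
  have hr1 : r < 1 := Real.rpow_lt_one_of_one_lt_of_neg one_lt_two (by linarith)
  have hblock (l : ℕ) : ∑ n ∈ Finset.Ico (2 ^ l) (2 ^ (l + 1)), f n ≤ r ^ l * d [true] := by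
    have hle : ∀ n ∈ Finset.Ico (2 ^ l) (2 ^ (l + 1)),
        f n ≤ ((2 : ℝ) ^ (-t)) ^ l * d (Nat.bits n).reverse := by
      intro n hn
      apply Set.indicator_apply_le'
      · rintro ⟨m, hm, rfl⟩
        have h1 : ((m : ℕ) : ℝ) ^ (-t) ≤ ((2 : ℝ) ^ (-t)) ^ l := by
          rw [← Real.rpow_natCast, ← Real.rpow_mul two_pos.le, mul_comm,
            Real.rpow_mul two_pos.le, Real.rpow_natCast]
          apply Real.rpow_le_rpow_of_nonpos (by positivity) _ (by linarith)
          exact_mod_cast (Finset.mem_Ico.1 hn).1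
        exact h1.trans (le_mul_of_one_le_right (by positivity) (hA m hm))
      · exact fun _ => mul_nonneg (by positivity) (hd.1 _)
    refine (Finset.sum_le_sum hle).trans (le_of_eq ?_)
    rw [← Finset.mul_sum, hd.sum_Ico_bits, ← mul_assoc, ← mul_pow, ← Real.rpow_add two_pos, hr]
    congr 3
    ring
  have hpow (L : ℕ) : ∑ n ∈ Finset.range (2 ^ L), f n
      ≤ (∑ l ∈ Finset.range L, r ^ l) * d [true] := by
    induction L with
    | zero => simp [f, B]
    | succ L ih =>
      rw [← Finset.sum_range_add_sum_Ico _ (Nat.pow_le_pow_right two_pos (Nat.le_succ L)),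
        Finset.sum_range_succ, add_mul]
      exact add_le_add ih (hblock L)
  have hf : Summable f := by
    refine summable_of_sum_range_le (c := (∑' l, r ^ l) * d [true]) hf0 fun N => ?_
    calc ∑ n ∈ Finset.range N, f n ≤ ∑ n ∈ Finset.range (2 ^ N), f n :=
          Finset.sum_le_sum_of_subset_of_nonneg
            (Finset.range_subset_range.2 Nat.lt_two_pow_self.le) fun n _ _ => hf0 n
      _ ≤ _ := hpow N
      _ ≤ _ := mul_le_mul_of_nonneg_right
          ((summable_geometric_of_lt_one hr0 hr1).sum_le_tsum _ fun l _ => by positivity)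
          (hd.1 _)
  have hinj : Function.Injective fun n : A => ((n : ℕ+) : ℕ) :=
    PNat.coe_injective.comp Subtype.val_injective
  refine (hf.comp_injective hinj).congr fun n => ?_
  exact Set.indicator_of_mem (show ((n : ℕ+) : ℕ) ∈ B from ⟨n, n.2, rfl⟩)
    fun n : ℕ => (n : ℝ) ^ (-t)

theorem isGale_one_const : IsGale 1 fun _ => 1 :=
  ⟨fun _ => zero_le_one, fun _ => by norm_num [Real.rpow_neg_one]⟩

/-- Gale characterization of zeta-dimension. -/
theorem zetaDim_eq_gale (A : Set ℕ+) :
    zetaDim A =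
      sInf {s : ℝ | 0 ≤ s ∧
        ∃ d : List Bool → ℝ, IsGale s d ∧ ∀ n ∈ A, SucceedsOn d n} := by
  have hup {s t : ℝ} (hs : 0 ≤ s) (hst : s < t) {d : List Bool → ℝ} (hd : IsGale s d)
      (hA : ∀ n ∈ A, SucceedsOn d n) :
      t ∈ {s : ℝ | 0 ≤ s ∧ (∑' n : A, (((n : ℕ+) : ℕ) : ENNReal) ^ (-s)) < ⊤} :=
    ⟨hs.trans hst.le, (zetaSum_lt_top_iff A t).2 (hd.summable_of_succeedsOn hs hst hA)⟩
  have hone : ∀ n ∈ A, SucceedsOn (fun _ => 1) n := fun _ _ => le_rfl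
  apply le_antisymm
  · refine le_csInf ⟨1, zero_le_one, _, isGale_one_const, hone⟩ ?_
    rintro s ⟨hs, d, hd, hA⟩
    exact le_of_forall_gt_imp_ge_of_dense fun t hst =>
      csInf_le ⟨0, fun _ h => h.1⟩ (hup hs hst hd hA)
  · refine csInf_le_csInf ⟨0, fun _ h => h.1⟩
      ⟨2, hup zero_le_one one_lt_two isGale_one_const hone⟩ ?_
    exact fun s ⟨hs, h⟩ => ⟨hs, exists_isGale_of_summable hs ((zetaSum_lt_top_iff A s).1 h)⟩
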